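/- Let k > 0, assume that every vertex of G is incident with at least one edge and that G has at least 6k edges. If P is a regular profile of S_{3k}(X), then P' := ^▷P ∩ S_k(Y) is a regular profile of S_k(Y). -/

import Mathlib

open Finset

namespace BipSep

variable {X Y : Type*} [Fintype X] [Fintype Y] [DecidableEq X] [DecidableEq Y]

/-- `|N(y) ∩ A|`: the number of neighbours of `y` in `A ⊆ X`, where the bipartite graph is
given by the adjacency relation `R : X → Y → Prop`. -/
def nX (R : X → Y → Prop) [∀ x y, Decidable (R x y)] (y : Y) (A : Finset X) : ℕ :=
  (A.filter fun x => R x y).card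

/-- `|N(x) ∩ C|` for `C ⊆ Y`. -/
def nY (R : X → Y → Prop) [∀ x y, Decidable (R x y)] (x : X) (C : Finset Y) : ℕ :=
  (C.filter fun y => R x y).card

/-- The order `|A,B|_X` of a separation `(A,B)` of `X`. -/
def ordX (R : X → Y → Prop) [∀ x y, Decidable (R x y)] (A B : Finset X) : ℚ :=
  ∑ y : Y, ((min (nX R y A) (nX R y B) : ℚ) - (nX R y (A ∩ B) : ℚ) / 2)

/-- The order `|C,D|_Y` of a separation `(C,D)` of `Y`. -/
def ordY (R : X → Y → Prop) [∀ x y, Decidable (R x y)] (C D : Finset Y) : ℚ :=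
  ∑ x : X, ((min (nY R x C) (nY R x D) : ℚ) - (nY R x (C ∩ D) : ℚ) / 2)

/-- `A^▷_B := {y ∈ Y : |N(y) ∩ A| ≥ |N(y) ∩ B|}`. -/
def shiftR1 (R : X → Y → Prop) [∀ x y, Decidable (R x y)] (A B : Finset X) : Finset Y :=
  univ.filter fun y => nX R y B ≤ nX R y A

/-- `B^▷_A := {y ∈ Y : |N(y) ∩ A| ≤ |N(y) ∩ B|}`. -/
def shiftR2 (R : X → Y → Prop) [∀ x y, Decidable (R x y)] (A B : Finset X) : Finset Y :=
  univ.filter fun y => nX R y A ≤ nX R y B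

/-- `C^◁_D := {x ∈ X : |N(x) ∩ C| ≥ |N(x) ∩ D|}`. -/
def shiftL1 (R : X → Y → Prop) [∀ x y, Decidable (R x y)] (C D : Finset Y) : Finset X :=
  univ.filter fun x => nY R x D ≤ nY R x C

/-- `D^◁_C := {x ∈ X : |N(x) ∩ C| ≤ |N(x) ∩ D|}`. -/
def shiftL2 (R : X → Y → Prop) [∀ x y, Decidable (R x y)] (C D : Finset Y) : Finset X :=
  univ.filter fun x => nY R x C ≤ nY R x D

instance (R : X → Y → Prop) [∀ x y, Decidable (R x y)] :
    DecidablePred fun p : X × Y => R p.1 p.2 :=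
  fun p => inferInstanceAs (Decidable (R p.1 p.2))

/-- The edge set of the bipartite graph with adjacency relation `R`: an edge is a pair
`(x,y)` with `x ∈ X`, `y ∈ Y` and `x` adjacent to `y`. -/
abbrev Edge (R : X → Y → Prop) := {p : X × Y // R p.1 p.2}

/-- `|E(x) ∩ C|` for a set `C` of edges. -/
def eX (R : X → Y → Prop) [∀ x y, Decidable (R x y)] (x : X) (C : Finset (Edge R)) : ℕ :=
  (C.filter fun e => e.1.1 = x).card

/-- `|E(y) ∩ C|` for a set `C` of edges. -/
def eY (R : X → Y → Prop) [∀ x y, Decidable (R x y)] (y : Y) (C : Finset (Edge R)) : ℕ :=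
  (C.filter fun e => e.1.2 = y).card

/-- The order `|C,D|_E` of a separation `(C,D)` of the edge set `E`. -/
def ordE (R : X → Y → Prop) [∀ x y, Decidable (R x y)] (C D : Finset (Edge R)) : ℚ :=
  (∑ x : X, ((min (eX R x C) (eX R x D) : ℚ) - (eX R x (C ∩ D) : ℚ) / 2)) +
    ∑ y : Y, ((min (eY R y C) (eY R y D) : ℚ) - (eY R y (C ∩ D) : ℚ) / 2)

/-- `C^◀_D := {x ∈ X : |E(x) ∩ C| ≥ |E(x) ∩ D|}`. -/
def bshift1 (R : X → Y → Prop) [∀ x y, Decidable (R x y)] (C D : Finset (Edge R)) : Finset X :=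
  univ.filter fun x => eX R x D ≤ eX R x C

/-- `D^◀_C := {x ∈ X : |E(x) ∩ C| ≤ |E(x) ∩ D|}`. -/
def bshift2 (R : X → Y → Prop) [∀ x y, Decidable (R x y)] (C D : Finset (Edge R)) : Finset X :=
  univ.filter fun x => eX R x C ≤ eX R x D

/-- `E(A)`: the set of edges with an endpoint in `A ⊆ X`. -/
def edgesOf (R : X → Y → Prop) [∀ x y, Decidable (R x y)] (A : Finset X) : Finset (Edge R) :=
  univ.filter fun e => e.1.1 ∈ A

/-- `|E(S,T)|`: the number of edges with `X`-endpoint in `T` and `Y`-endpoint in `S`. -/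
def eCount (R : X → Y → Prop) [∀ x y, Decidable (R x y)] (T : Finset X) (S : Finset Y) : ℕ :=
  (univ.filter fun e : Edge R => e.1.1 ∈ T ∧ e.1.2 ∈ S).card

/-- `S_k`: the set of oriented separations of order `< k`, with respect to the
order function `ord`. -/
def Sk {V : Type*} [Fintype V] [DecidableEq V] (ord : Finset V → Finset V → ℚ) (k : ℚ) :
    Set (Finset V × Finset V) :=
  {p | p.1 ∪ p.2 = univ ∧ ord p.1 p.2 < k}

/-- A tangle of `S_k`: a set of oriented separations, all of order `< k`, containing exactly
one of `(A,B)`, `(B,A)` for every separation of order `< k`, such that no three of its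
members have their left-hand sides covering the whole ground set. -/
def IsTangle {V : Type*} [Fintype V] [DecidableEq V] (ord : Finset V → Finset V → ℚ)
    (k : ℚ) (τ : Set (Finset V × Finset V)) : Prop :=
  (∀ p ∈ τ, p.1 ∪ p.2 = univ ∧ ord p.1 p.2 < k) ∧
  (∀ A B : Finset V, A ∪ B = univ → ord A B < k → ((A, B) ∈ τ ↔ (B, A) ∉ τ)) ∧
  ∀ p₁ ∈ τ, ∀ p₂ ∈ τ, ∀ p₃ ∈ τ, p₁.1 ∪ p₂.1 ∪ p₃.1 ≠ univ

/-- A profile of `S_k`: an orientation of `S_k` that is consistent and closed under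
the profile property. -/
def IsProfile {V : Type*} [Fintype V] [DecidableEq V] (ord : Finset V → Finset V → ℚ)
    (k : ℚ) (P : Set (Finset V × Finset V)) : Prop :=
  (∀ p ∈ P, p.1 ∪ p.2 = univ ∧ ord p.1 p.2 < k) ∧
  (∀ A B : Finset V, A ∪ B = univ → ord A B < k → ((A, B) ∈ P ↔ (B, A) ∉ P)) ∧
  (∀ A₁ B₁ A₂ B₂ : Finset V, A₁ ⊆ A₂ → B₂ ⊆ B₁ →
    ¬((A₁ = A₂ ∧ B₁ = B₂) ∨ (A₁ = B₂ ∧ B₁ = A₂)) →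
    ¬((B₁, A₁) ∈ P ∧ (A₂, B₂) ∈ P)) ∧
  ∀ p₁ ∈ P, ∀ p₂ ∈ P, (p₁.2 ∩ p₂.2, p₁.1 ∪ p₂.1) ∉ P

/-- A regular profile: a profile containing no separation of the form `(V,B)`. -/
def IsRegularProfile {V : Type*} [Fintype V] [DecidableEq V] (ord : Finset V → Finset V → ℚ)
    (k : ℚ) (P : Set (Finset V × Finset V)) : Prop :=
  IsProfile ord k P ∧ ∀ B : Finset V, (univ, B) ∉ P

/-- `^▷τ`: the separations `(C,D)` of `Y` whose shift `(C,D)^◁` lies in `τ`. -/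
def pullY (R : X → Y → Prop) [∀ x y, Decidable (R x y)] (τ : Set (Finset X × Finset X)) :
    Set (Finset Y × Finset Y) :=
  {q | q.1 ∪ q.2 = univ ∧ (shiftL1 R q.1 q.2, shiftL2 R q.1 q.2) ∈ τ}

/-- `^◁τ`: the separations `(A,B)` of `X` whose shift `(A,B)^▷` lies in `τ`. -/
def pullX (R : X → Y → Prop) [∀ x y, Decidable (R x y)] (τ : Set (Finset Y × Finset Y)) :
    Set (Finset X × Finset X) :=
  {p | p.1 ∪ p.2 = univ ∧ (shiftR1 R p.1 p.2, shiftR2 R p.1 p.2) ∈ τ}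

/-- `τ_E`: the separations `(C,D)` of `E` whose shift `(C,D)^◀` lies in `τ`. -/
def pullE (R : X → Y → Prop) [∀ x y, Decidable (R x y)] (τ : Set (Finset X × Finset X)) :
    Set (Finset (Edge R) × Finset (Edge R)) :=
  {q | q.1 ∪ q.2 = univ ∧ (bshift1 R q.1 q.2, bshift2 R q.1 q.2) ∈ τ}

/-- `τ_X := {(C,D)^◀ : (C,D) ∈ τ}`. -/
def pushX (R : X → Y → Prop) [∀ x y, Decidable (R x y)]
    (τ : Set (Finset (Edge R) × Finset (Edge R))) : Set (Finset X × Finset X) :=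
  {p | ∃ q ∈ τ, (bshift1 R q.1 q.2, bshift2 R q.1 q.2) = p}

set_option linter.unusedSectionVars false

theorem nY_mono (R : X → Y → Prop) [∀ x y, Decidable (R x y)] (x : X) {C D : Finset Y}
    (h : C ⊆ D) : (nY R x C : ℚ) ≤ nY R x D := by
  exact_mod_cast card_le_card (filter_subset_filter _ h)

theorem nY_union_add_inter (R : X → Y → Prop) [∀ x y, Decidable (R x y)] (x : X)
    (C D : Finset Y) :
    (nY R x (C ∪ D) : ℚ) + nY R x (C ∩ D) = nY R x C + nY R x D := by
  have h := card_union_add_card_inter (C.filter fun y => R x y) (D.filter fun y => R x y)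
  rw [← filter_union, ← filter_inter_distrib] at h
  exact_mod_cast h

theorem nY_eq_sum (R : X → Y → Prop) [∀ x y, Decidable (R x y)] (x : X) (C : Finset Y) :
    (nY R x C : ℚ) = ∑ y, if R x y then (if y ∈ C then 1 else 0) else 0 := by
  simp only [← ite_and, nY, card_filter, Nat.cast_sum, Nat.cast_ite, Nat.cast_one, Nat.cast_zero]
  rw [← sum_filter, ← sum_filter]
  congr 1
  ext y
  simp [and_comm]

/-- The order of a separation depends only on the degrees and on the differences
`|N(x) ∩ C| - |N(x) ∩ D|`. -/
theorem ordY_eq (R : X → Y → Prop) [∀ x y, Decidable (R x y)] {C D : Finset Y}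
    (h : C ∪ D = univ) :
    ordY R C D = ∑ x, ((nY R x univ : ℚ) - |(nY R x C : ℚ) - nY R x D|) / 2 := by
  refine sum_congr rfl fun x _ => ?_
  have h₁ := nY_union_add_inter R x C D
  rw [h] at h₁
  rcases le_total (nY R x C : ℚ) (nY R x D) with h₂ | h₂
  · rw [min_eq_left h₂, abs_of_nonpos (by linarith)]
    linarith
  · rw [min_eq_right h₂, abs_of_nonneg (by linarith)]
    linarith

theorem ordY_comm (R : X → Y → Prop) [∀ x y, Decidable (R x y)] (C D : Finset Y) :
    ordY R C D = ordY R D C := by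
  simp only [ordY, min_comm, inter_comm]

theorem abs_nY_sub_le (R : X → Y → Prop) [∀ x y, Decidable (R x y)] (x : X)
    (C D : Finset Y) : |(nY R x C : ℚ) - nY R x D| ≤ nY R x univ := by
  have h₁ := nY_mono R x (subset_univ C)
  have h₂ := nY_mono R x (subset_univ D)
  rw [abs_le]
  constructor <;> linarith [Nat.cast_nonneg (α := ℚ) (nY R x C),
    Nat.cast_nonneg (α := ℚ) (nY R x D)]

theorem ordY_union_inter_le (R : X → Y → Prop) [∀ x y, Decidable (R x y)]
    {C₁ D₁ C₂ D₂ : Finset Y} (h₁ : C₁ ∪ D₁ = univ) (h₂ : C₂ ∪ D₂ = univ) :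
    ordY R (C₁ ∪ C₂) (D₁ ∩ D₂) ≤ ordY R C₁ D₁ + ordY R C₂ D₂ := by
  have h : (C₁ ∪ C₂) ∪ (D₁ ∩ D₂) = univ := by
    ext y
    have a := mem_univ y
    have b := mem_univ y
    rw [← h₁] at a
    rw [← h₂] at b
    simp only [mem_union, mem_inter, mem_univ, iff_true] at a b ⊢
    tauto
  rw [ordY_eq R h, ordY_eq R h₁, ordY_eq R h₂, ← sum_add_distrib]
  refine sum_le_sum fun x _ => ?_
  have a := nY_union_add_inter R x C₁ C₂
  have b := nY_union_add_inter R x D₁ D₂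
  have c := abs_nY_sub_le R x (C₁ ∩ C₂) (D₁ ∪ D₂)
  have m₁ := nY_mono R x (subset_union_left (s₁ := C₁) (s₂ := C₂))
  have m₂ := nY_mono R x (subset_union_right (s₁ := C₁) (s₂ := C₂))
  have m₃ := nY_mono R x (inter_subset_left (s₁ := D₁) (s₂ := D₂))
  have m₄ := nY_mono R x (inter_subset_right (s₁ := D₁) (s₂ := D₂))
  rw [abs_le] at c
  have e₁ := le_abs_self ((nY R x (C₁ ∪ C₂) : ℚ) - nY R x (D₁ ∩ D₂))
  have e₂ := neg_le_abs ((nY R x (C₁ ∪ C₂) : ℚ) - nY R x (D₁ ∩ D₂))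
  have f₁ := abs_nY_sub_le R x C₁ D₁
  have f₂ := abs_nY_sub_le R x C₂ D₂
  rcases abs_cases ((nY R x C₁ : ℚ) - nY R x D₁) with ⟨g₁, _⟩ | ⟨g₁, _⟩ <;>
  rcases abs_cases ((nY R x C₂ : ℚ) - nY R x D₂) with ⟨g₂, _⟩ | ⟨g₂, _⟩ <;>
  rw [g₁, g₂] <;> rw [g₁] at f₁ <;> rw [g₂] at f₂ <;> linarith

theorem ordX_union_inter_le (R : X → Y → Prop) [∀ x y, Decidable (R x y)]
    {A₁ B₁ A₂ B₂ : Finset X} (h₁ : A₁ ∪ B₁ = univ) (h₂ : A₂ ∪ B₂ = univ) :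
    ordX R (A₁ ∪ A₂) (B₁ ∩ B₂) ≤ ordX R A₁ B₁ + ordX R A₂ B₂ :=
  ordY_union_inter_le (fun y x => R x y) h₁ h₂

theorem ordX_comm (R : X → Y → Prop) [∀ x y, Decidable (R x y)] (A B : Finset X) :
    ordX R A B = ordX R B A :=
  ordY_comm (fun y x => R x y) A B

theorem nX_eq_sum (R : X → Y → Prop) [∀ x y, Decidable (R x y)] (y : Y) (A : Finset X) :
    (nX R y A : ℚ) = ∑ x, if R x y then (if x ∈ A then 1 else 0) else 0 :=
  nY_eq_sum (fun y x => R x y) y A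

theorem ordX_eq (R : X → Y → Prop) [∀ x y, Decidable (R x y)] {A B : Finset X}
    (h : A ∪ B = univ) :
    ordX R A B = ∑ y, ((nX R y univ : ℚ) - |(nX R y A : ℚ) - nX R y B|) / 2 :=
  ordY_eq (fun y x => R x y) h

theorem shiftL_union (R : X → Y → Prop) [∀ x y, Decidable (R x y)] (C D : Finset Y) :
    shiftL1 R C D ∪ shiftL2 R C D = univ := by
  ext x
  simpa [shiftL1, shiftL2] using le_total (nY R x D) (nY R x C)

/-- Counting the edges at a set of vertices from either side. -/
theorem sum_nX_eq (R : X → Y → Prop) [∀ x y, Decidable (R x y)] (W : Finset X) :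
    ∑ y, (nX R y W : ℚ) = ∑ x ∈ W, (nY R x univ : ℚ) := by
  simp only [nX_eq_sum, nY_eq_sum, mem_univ, if_true]
  rw [sum_comm, ← sum_filter_add_sum_filter_not univ (· ∈ W)]
  rw [sum_eq_zero (s := univ.filter fun x => x ∉ W), filter_univ_mem, add_zero]
  · refine sum_congr rfl fun x hx => ?_
    simp [hx]
  · intro x hx
    simp [(mem_filter.1 hx).2]

/-- Shifting does not increase the order. -/
theorem ordX_shiftL_le (R : X → Y → Prop) [∀ x y, Decidable (R x y)] {C D : Finset Y}
    (h : C ∪ D = univ) : ordX R (shiftL1 R C D) (shiftL2 R C D) ≤ ordY R C D := by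
  rw [ordX_eq R (shiftL_union R C D), ordY_eq R h, ← sum_div, ← sum_div, sum_sub_distrib,
    sum_sub_distrib, sum_nX_eq]
  set A := shiftL1 R C D with hA
  set B := shiftL2 R C D with hB
  let f : Y → ℚ := fun y => (if y ∈ C then 1 else 0) - (if y ∈ D then 1 else 0)
  let g : X → ℚ := fun x => (if x ∈ A then 1 else 0) - (if x ∈ B then 1 else 0)
  have hf : ∀ x, (nY R x C : ℚ) - nY R x D = ∑ y, if R x y then f y else 0 := by
    intro x
    rw [nY_eq_sum, nY_eq_sum, ← sum_sub_distrib]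
    refine sum_congr rfl fun y _ => ?_
    split_ifs <;> simp_all [f]
  have hg : ∀ y, (nX R y A : ℚ) - nX R y B = ∑ x, if R x y then g x else 0 := by
    intro y
    rw [nX_eq_sum, nX_eq_sum, ← sum_sub_distrib]
    refine sum_congr rfl fun x _ => ?_
    split_ifs <;> simp_all [g]
  have h₁ : ∀ x, |(nY R x C : ℚ) - nY R x D| = g x * ((nY R x C : ℚ) - nY R x D) := by
    intro x
    simp only [g, hA, hB, shiftL1, shiftL2, mem_filter, mem_univ, true_and]
    rcases lt_trichotomy (nY R x C) (nY R x D) with q | q | q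
    · have q' : (nY R x C : ℚ) < nY R x D := by exact_mod_cast q
      rw [if_neg (by omega), if_pos (by omega), abs_of_neg (by linarith)]
      ring
    · simp [q]
    · have q' : (nY R x D : ℚ) < nY R x C := by exact_mod_cast q
      rw [if_pos (by omega), if_neg (by omega), abs_of_pos (by linarith)]
      ring
  have h₂ : ∀ y, f y * ((nX R y A : ℚ) - nX R y B) ≤ |(nX R y A : ℚ) - nX R y B| := by
    intro y
    have hle : |f y| ≤ 1 := by
      simp only [f]
      split_ifs <;> norm_num
    calc _ ≤ |f y * ((nX R y A : ℚ) - nX R y B)| := le_abs_self _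
      _ = |f y| * |(nX R y A : ℚ) - nX R y B| := abs_mul _ _
      _ ≤ _ := mul_le_of_le_one_left (abs_nonneg _) hle
  have h₃ : ∑ x, |(nY R x C : ℚ) - nY R x D| ≤ ∑ y, |(nX R y A : ℚ) - nX R y B| := by
    calc _ = ∑ x, g x * ((nY R x C : ℚ) - nY R x D) := sum_congr rfl fun x _ => h₁ x
      _ = ∑ y, f y * ((nX R y A : ℚ) - nX R y B) := by
        simp only [hf, hg, mul_sum]
        rw [sum_comm]
        refine sum_congr rfl fun y _ => sum_congr rfl fun x _ => ?_
        split_ifs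
        · ring
        · simp
      _ ≤ _ := sum_le_sum fun y _ => h₂ y
  linarith

theorem ordX_univ_right (R : X → Y → Prop) [∀ x y, Decidable (R x y)] (W : Finset X) :
    ordX R W univ = (∑ x ∈ W, (nY R x univ : ℚ)) / 2 := by
  rw [← sum_nX_eq, sum_div]
  refine sum_congr rfl fun y _ => ?_
  have h : (nX R y W : ℚ) ≤ nX R y univ := nY_mono (fun y x => R x y) y (subset_univ W)
  rw [min_eq_left h, inter_univ]
  ring

/-- A vertex on the right-hand side of the shifts of both `(C₁,D₁)` and `(C₂,D₂)`, but on the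
left-hand side of the shift of their supremum, contributes at least its degree to the total
order of these three separations. -/
theorem ordX_inter_shiftL_le (R : X → Y → Prop) [∀ x y, Decidable (R x y)]
    {C₁ D₁ C₂ D₂ : Finset Y} (h₁ : C₁ ∪ D₁ = univ) (h₂ : C₂ ∪ D₂ = univ)
    (h : (D₁ ∩ D₂) ∪ (C₁ ∪ C₂) = univ) :
    ordX R (shiftL2 R C₁ D₁ ∩ shiftL2 R C₂ D₂ ∩ shiftL2 R (D₁ ∩ D₂) (C₁ ∪ C₂)) univ ≤
      (ordY R C₁ D₁ + ordY R C₂ D₂ + ordY R (D₁ ∩ D₂) (C₁ ∪ C₂)) / 2 := by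
  rw [ordX_univ_right, ordY_eq R h, ordY_eq R h₁, ordY_eq R h₂, ← sum_add_distrib,
    ← sum_add_distrib]
  refine div_le_div_of_nonneg_right ?_ zero_le_two
  refine (sum_le_sum fun x hx => ?_).trans
    (sum_le_sum_of_subset_of_nonneg (subset_univ _) fun x _ _ => ?_)
  · simp only [shiftL2, mem_inter, mem_filter, mem_univ, true_and] at hx
    obtain ⟨⟨q₁, q₂⟩, q₃⟩ := hx
    have q₁ : (nY R x C₁ : ℚ) ≤ nY R x D₁ := by exact_mod_cast q₁
    have q₂ : (nY R x C₂ : ℚ) ≤ nY R x D₂ := by exact_mod_cast q₂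
    have q₃ : (nY R x (D₁ ∩ D₂) : ℚ) ≤ nY R x (C₁ ∪ C₂) := by exact_mod_cast q₃
    have a := nY_union_add_inter R x C₁ C₂
    have b := nY_union_add_inter R x D₁ D₂
    have c := abs_nY_sub_le R x (C₁ ∩ C₂) (D₁ ∪ D₂)
    rw [abs_le] at c
    rw [abs_of_nonpos (sub_nonpos.2 q₁), abs_of_nonpos (sub_nonpos.2 q₂),
      abs_of_nonpos (sub_nonpos.2 q₃)]
    linarith
  · linarith [abs_nY_sub_le R x C₁ D₁, abs_nY_sub_le R x C₂ D₂,
      abs_nY_sub_le R x (D₁ ∩ D₂) (C₁ ∪ C₂)]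

theorem shiftL1_mono (R : X → Y → Prop) [∀ x y, Decidable (R x y)] {C₁ D₁ C₂ D₂ : Finset Y}
    (hC : C₁ ⊆ C₂) (hD : D₂ ⊆ D₁) : shiftL1 R C₁ D₁ ⊆ shiftL1 R C₂ D₂ := by
  intro x hx
  simp only [shiftL1, mem_filter, mem_univ, true_and] at hx ⊢
  exact (card_le_card (filter_subset_filter _ hD)).trans
    (hx.trans (card_le_card (filter_subset_filter _ hC)))

theorem IsProfile.sup_mem {V : Type*} [Fintype V] [DecidableEq V]
    {ord : Finset V → Finset V → ℚ} {k : ℚ} {P : Set (Finset V × Finset V)}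
    (hP : IsProfile ord k P) {A₁ B₁ A₂ B₂ : Finset V} (h₁ : (A₁, B₁) ∈ P)
    (h₂ : (A₂, B₂) ∈ P) (h : ord (A₁ ∪ A₂) (B₁ ∩ B₂) < k) : (A₁ ∪ A₂, B₁ ∩ B₂) ∈ P := by
  refine (hP.2.1 _ _ ?_ h).2 (hP.2.2.2 _ h₁ _ h₂)
  have a := (hP.1 _ h₁).1
  have b := (hP.1 _ h₂).1
  simp only [Finset.ext_iff, mem_union, mem_inter, mem_univ, iff_true] at a b ⊢
  intro v
  have := a v
  have := b v
  tauto

/-- If `P` is a regular profile of `S_{3k}(X)`, then `^▷P ∩ S_k(Y)` is a regular profile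
of `S_k(Y)`. -/
theorem profile_shift (R : X → Y → Prop) [∀ x y, Decidable (R x y)] (k : ℚ) (hk : 0 < k)
    (hdegX : ∀ x : X, ∃ y : Y, R x y) (hdegY : ∀ y : Y, ∃ x : X, R x y)
    (hE : 6 * k ≤ (Fintype.card (Edge R) : ℚ))
    (P : Set (Finset X × Finset X)) (hP : IsRegularProfile (ordX R) (3 * k) P) :
    IsRegularProfile (ordY R) k (pullY R P ∩ Sk (ordY R) k) := by
  obtain ⟨hprof, hreg⟩ := hP
  obtain ⟨hS, hor, hcons, hpr⟩ := hprof
  refine ⟨⟨fun p hp => hp.2, ?_, ?_, ?_⟩, ?_⟩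
  · intro C D hCD hord
    have hDC : D ∪ C = univ := by rwa [union_comm]
    have hlt : ordX R (shiftL1 R C D) (shiftL2 R C D) < 3 * k := by
      linarith [ordX_shiftL_le R hCD]
    have key := hor _ _ (shiftL_union R C D) hlt
    constructor
    · rintro ⟨⟨_, h⟩, _⟩ ⟨⟨_, h'⟩, _⟩
      exact key.1 h h'
    · intro h
      refine ⟨⟨hCD, key.2 fun h' => h ⟨⟨hDC, h'⟩, hDC, ?_⟩⟩, hCD, hord⟩
      rwa [ordY_comm R D C]
  · rintro C₁ D₁ C₂ D₂ hC hD - ⟨⟨⟨_, h₁⟩, _⟩, ⟨_, h₂⟩, _⟩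
    have hA : shiftL1 R C₁ D₁ ⊆ shiftL1 R C₂ D₂ := shiftL1_mono R hC hD
    have hB : shiftL2 R C₂ D₂ ⊆ shiftL2 R C₁ D₁ := shiftL1_mono R hD hC
    refine hcons _ _ _ _ hA hB ?_ ⟨h₁, h₂⟩
    rintro (⟨e₁, e₂⟩ | ⟨e₁, e₂⟩)
    · have h₁' : (shiftL2 R C₁ D₁, shiftL1 R C₁ D₁) ∈ P := h₁
      rw [e₁, e₂] at h₁'
      exact (hor _ _ (shiftL_union R C₂ D₂) (hS _ h₂).2).1 h₂ h₁'
    · refine hreg (shiftL2 R C₂ D₂) ?_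
      have hu := shiftL_union R C₂ D₂
      rw [← e₁, union_eq_left.2 hA] at hu
      rwa [← hu]
  · rintro ⟨C₁, D₁⟩ ⟨⟨hu₁, h₁⟩, _, ho₁⟩ ⟨C₂, D₂⟩ ⟨⟨hu₂, h₂⟩, _, ho₂⟩ ⟨⟨hu, h⟩, _, ho⟩
    dsimp only at hu₁ h₁ ho₁ hu₂ h₂ ho₂ hu h ho
    have hprof : IsProfile (ordX R) (3 * k) P := ⟨hS, hor, hcons, hpr⟩
    have l₁ := ordX_shiftL_le R hu₁
    have l₂ := ordX_shiftL_le R hu₂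
    have l := ordX_shiftL_le R hu
    have s := ordX_union_inter_le R (shiftL_union R C₁ D₁) (shiftL_union R C₂ D₂)
    have m := hprof.sup_mem h₁ h₂ (by linarith)
    have s' := ordX_union_inter_le R (hS _ m).1 (hS _ h).1
    have m' := hprof.sup_mem m h (by dsimp only at s'; linarith)
    have w := ordX_inter_shiftL_le R hu₁ hu₂ hu
    set W := shiftL2 R C₁ D₁ ∩ shiftL2 R C₂ D₂ ∩ shiftL2 R (D₁ ∩ D₂) (C₁ ∪ C₂)
    have hW : (W, univ) ∈ P := (hor _ _ (union_eq_right.2 (subset_univ W)) (by linarith)).2 (hreg W)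
    have hu' := (hS _ m').1
    refine hpr _ m' _ hW ?_
    have e : (shiftL1 R C₁ D₁ ∪ shiftL1 R C₂ D₂ ∪ shiftL1 R (D₁ ∩ D₂) (C₁ ∪ C₂)) ∪ W = univ := hu'
    dsimp only
    rwa [inter_univ, e]
  · rintro D ⟨⟨_, h⟩, _⟩
    have e : shiftL1 R univ D = univ := by
      ext x
      simp only [shiftL1, mem_filter, mem_univ, true_and, iff_true]
      exact card_le_card (filter_subset_filter _ (subset_univ D))
    dsimp only at h
    rw [e] at h
    exact hreg _ h

end BipSep
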